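/- (Discrete Korn inequality.) Suppose the network is quasi-triangulated, and let Q_hom(T¹,…,T^N) = (1/2)·Σ_{i=1}^N Σ_{j: j∼i} C^{ij}_sp·⟨Tⁱ − Tʲ, q^{ij}⟩² + Σ_{i∈I} C^i_sp·⟨Tⁱ, qⁱ⟩² (the truncated dissipation functional with zero boundary data). Then there exists a constant C > 0 such that Q_hom(T¹,…,T^N) ≥ C·Σ_{i=1}^N ‖Tⁱ‖² for every (T¹,…,T^N) ∈ (ℝ²)^N satisfying Σ_{i=1}^N ⟨Tⁱ, e₁⟩ = 0. -/

import Mathlib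

noncomputable section

/-- Dot product on ℝ² (represented as `Fin 2 → ℝ`). -/
def dot (v w : Fin 2 → ℝ) : ℝ := v 0 * w 0 + v 1 * w 1

/-- First standard basis vector of ℝ². -/
def e1 : Fin 2 → ℝ := ![1, 0]

/-- Second standard basis vector of ℝ². -/
def e2 : Fin 2 → ℝ := ![0, 1]

/-- On a subspace of a finite-dimensional space, a continuous `2`-homogeneous function which is
positive away from the origin dominates every continuous `2`-homogeneous function up to a
constant. -/
theorem exists_pos_mul_le_of_sq_homogeneous {E : Type*} [NormedAddCommGroup E] [NormedSpace ℝ E]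
    [FiniteDimensional ℝ E] (K : Submodule ℝ E) {P Q : E → ℝ}
    (hPc : Continuous P) (hQc : Continuous Q)
    (hP : ∀ (c : ℝ) x, P (c • x) = c ^ 2 * P x) (hQ : ∀ (c : ℝ) x, Q (c • x) = c ^ 2 * Q x)
    (hpos : ∀ x ∈ K, x ≠ 0 → 0 < Q x) :
    ∃ C : ℝ, 0 < C ∧ ∀ x ∈ K, C * P x ≤ Q x := by
  have : ProperSpace E := FiniteDimensional.proper_real E
  have hcomp : IsCompact (Metric.sphere (0 : E) 1 ∩ (K : Set E)) :=
    (isCompact_sphere _ _).inter_right K.closed_of_finiteDimensional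
  obtain ⟨δ, hδ, hδQ⟩ := hcomp.exists_forall_le' (a := 0) hQc.continuousOn fun x hx =>
    hpos x hx.2 (ne_zero_of_mem_unit_sphere ⟨x, hx.1⟩)
  obtain ⟨M, hM⟩ := hcomp.bddAbove_image hPc.continuousOn
  have hM1 : 0 < |M| + 1 := by positivity
  refine ⟨δ / (|M| + 1), by positivity, fun x hx => ?_⟩
  rcases eq_or_ne x 0 with rfl | hx0
  · have hP0 := hP 0 0
    have hQ0 := hQ 0 0
    simp only [zero_smul] at hP0 hQ0
    rw [hP0, hQ0]
    simp
  have hmem : ‖x‖⁻¹ • x ∈ Metric.sphere (0 : E) 1 ∩ (K : Set E) :=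
    ⟨by simp [norm_smul, hx0], K.smul_mem _ hx⟩
  have hscale : x = ‖x‖ • ‖x‖⁻¹ • x := by
    rw [smul_smul, mul_inv_cancel₀ (norm_ne_zero_iff.2 hx0), one_smul]
  have hPu : P (‖x‖⁻¹ • x) ≤ |M| + 1 :=
    (hM ⟨_, hmem, rfl⟩).trans ((le_abs_self M).trans (by linarith))
  have hunit : δ / (|M| + 1) * P (‖x‖⁻¹ • x) ≤ Q (‖x‖⁻¹ • x) :=
    calc δ / (|M| + 1) * P (‖x‖⁻¹ • x) ≤ δ / (|M| + 1) * (|M| + 1) := by gcongr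
      _ = δ := div_mul_cancel₀ _ hM1.ne'
      _ ≤ _ := hδQ _ hmem
  rw [hscale, hP, hQ]
  calc δ / (|M| + 1) * (‖x‖ ^ 2 * P (‖x‖⁻¹ • x))
      = ‖x‖ ^ 2 * (δ / (|M| + 1) * P (‖x‖⁻¹ • x)) := by ring
    _ ≤ _ := by gcongr

/-- A planar vector orthogonal to two linearly independent vectors vanishes. -/
theorem eq_zero_of_dot_eq_zero {u a b : Fin 2 → ℝ} (hab : LinearIndependent ℝ ![a, b])
    (ha : dot u a = 0) (hb : dot u b = 0) : u = 0 := by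
  have hdet : a 0 * b 1 - a 1 * b 0 ≠ 0 := by
    have h := Matrix.linearIndependent_rows_iff_isUnit (A := Matrix.of ![a, b]) |>.1 hab
    rw [Matrix.isUnit_iff_isUnit_det, Matrix.det_fin_two, isUnit_iff_ne_zero] at h
    simpa using h
  simp only [dot] at ha hb
  ext k
  fin_cases k
  · refine (mul_eq_zero.1 (?_ : u 0 * (a 0 * b 1 - a 1 * b 0) = 0)).resolve_right hdet
    linear_combination b 1 * ha - a 1 * hb
  · refine (mul_eq_zero.1 (?_ : u 1 * (a 0 * b 1 - a 1 * b 0) = 0)).resolve_right hdet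
    linear_combination a 0 * hb - b 0 * ha

/-- In a quasi-triangulated network, a configuration with no strain along any edge and no
vertical component on the lower boundary is a horizontal translation. -/
theorem exists_eq_of_strain_eq_zero {ι : Type*} {adj : ι → ι → Prop} {q : ι → ι → Fin 2 → ℝ}
    {Iminus : Finset ι} (hne : Iminus.Nonempty)
    (hconn : ∀ i ∈ Iminus, ∀ j ∈ Iminus, ∃ (m : ℕ) (p : Fin (m + 1) → ι),
      p 0 = i ∧ p (Fin.last m) = j ∧ (∀ k, p k ∈ Iminus) ∧
      ∀ k : Fin m, adj (p k.castSucc) (p k.succ) ∧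
        dot (q (p k.castSucc) (p k.succ)) e1 ≠ 0)
    {m : ℕ} {v : Fin m → ι} (hv : ∀ x, x ∉ Iminus ↔ ∃ k, v k = x)
    (htri : ∀ k : Fin m, ∃ j1 j2 : ι,
        adj (v k) j1 ∧ adj (v k) j2 ∧
        (j1 ∈ Iminus ∨ ∃ l, l < k ∧ v l = j1) ∧
        (j2 ∈ Iminus ∨ ∃ l, l < k ∧ v l = j2) ∧
        LinearIndependent ℝ ![q (v k) j1, q (v k) j2])
    {T : ι → Fin 2 → ℝ} (hedge : ∀ i j, adj i j → dot (T i - T j) (q i j) = 0)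
    (hbdry : ∀ i ∈ Iminus, T i 1 = 0) :
    ∃ c : Fin 2 → ℝ, c 1 = 0 ∧ ∀ i, T i = c := by
  obtain ⟨i₀, hi₀⟩ := hne
  have hminus : ∀ j ∈ Iminus, T j = T i₀ := by
    intro j hj
    obtain ⟨n, p, hp0, hpn, hpI, hp⟩ := hconn i₀ hi₀ j hj
    have hpath : ∀ k, T (p k) = T i₀ := by
      intro k
      induction k using Fin.induction with
      | zero => rw [hp0]
      | succ k ih =>
        obtain ⟨hadj, hq⟩ := hp k
        have h := hedge _ _ hadj
        have hvert := hbdry _ (hpI k.succ)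
        have hvert' := hbdry _ (hpI k.castSucc)
        simp only [dot, e1, Pi.sub_apply, hvert, hvert', Matrix.cons_val_zero,
          Matrix.cons_val_one, mul_one, mul_zero, add_zero, sub_self, zero_mul] at h hq
        have hhor := (mul_eq_zero.1 h).resolve_right hq
        rw [← ih]
        ext l
        fin_cases l
        · exact (sub_eq_zero.1 hhor).symm
        · exact hvert.trans hvert'.symm
    rw [← hpn, hpath]
  have hinner : ∀ k, T (v k) = T i₀ := by
    intro k
    induction k using WellFoundedLT.induction with
    | ind k ih =>
      obtain ⟨j1, j2, ha1, ha2, h1, h2, hli⟩ := htri k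
      have hprev : ∀ j, (j ∈ Iminus ∨ ∃ l, l < k ∧ v l = j) → T j = T i₀ := by
        rintro j (hj | ⟨l, hl, rfl⟩)
        exacts [hminus j hj, ih l hl]
      have hd1 := hedge _ _ ha1
      have hd2 := hedge _ _ ha2
      rw [hprev _ h1] at hd1
      rw [hprev _ h2] at hd2
      exact sub_eq_zero.1 (eq_zero_of_dot_eq_zero hli hd1 hd2)
  refine ⟨T i₀, hbdry i₀ hi₀, fun i => ?_⟩
  by_cases hi : i ∈ Iminus
  · exact hminus i hi
  · obtain ⟨k, rfl⟩ := (hv i).1 hi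
    exact hinner k

/-- discrete Korn inequality: for a quasi-triangulated network
there is C > 0 with Q_hom(T) ≥ C·Σᵢ ‖Tⁱ‖² for every T with Σᵢ ⟨Tⁱ, e₁⟩ = 0. -/
theorem stmt10
    (N : ℕ)
    (adj : Fin N → Fin N → Prop) [DecidableRel adj]
    (hsymm : ∀ i j, adj i j → adj j i)
    (hirrefl : ∀ i, ¬ adj i i)
    (q : Fin N → Fin N → Fin 2 → ℝ)
    (hq_unit : ∀ i j, adj i j → dot (q i j) (q i j) = 1)
    (hq_anti : ∀ i j, adj i j → q j i = -q i j)
    (Iplus Iminus : Finset (Fin N))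
    (hdisj : Disjoint Iplus Iminus)
    (qb : Fin N → Fin 2 → ℝ)
    (hqb_plus : ∀ i ∈ Iplus, qb i = e2)
    (hqb_minus : ∀ i ∈ Iminus, qb i = -e2)
    (Csp : Fin N → Fin N → ℝ)
    (hCsp_symm : ∀ i j, Csp i j = Csp j i)
    (hCsp_pos : ∀ i j, adj i j → 0 < Csp i j)
    (Cb : Fin N → ℝ)
    (hCb_pos : ∀ i ∈ Iplus ∪ Iminus, 0 < Cb i)
    -- quasi-triangulation, condition (i)
    (hne : Iminus.Nonempty)
    (hconn : ∀ i ∈ Iminus, ∀ j ∈ Iminus, ∃ (m : ℕ) (p : Fin (m + 1) → Fin N),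
      p 0 = i ∧ p (Fin.last m) = j ∧ (∀ k, p k ∈ Iminus) ∧
      ∀ k : Fin m, adj (p k.castSucc) (p k.succ) ∧
        dot (q (p k.castSucc) (p k.succ)) e1 ≠ 0)
    -- quasi-triangulation, condition (ii)
    (henum : ∃ (m : ℕ) (v : Fin m → Fin N), Function.Injective v ∧
      (∀ x : Fin N, x ∉ Iminus ↔ ∃ k, v k = x) ∧
      ∀ k : Fin m, ∃ j1 j2 : Fin N,
        adj (v k) j1 ∧ adj (v k) j2 ∧
        (j1 ∈ Iminus ∨ ∃ l, l < k ∧ v l = j1) ∧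
        (j2 ∈ Iminus ∨ ∃ l, l < k ∧ v l = j2) ∧
        LinearIndependent ℝ ![q (v k) j1, q (v k) j2])
    -- the homogeneous truncated dissipation functional
    (Qhom : (Fin N → Fin 2 → ℝ) → ℝ)
    (hQhom : ∀ T, Qhom T =
      (1/2) * ∑ i, ∑ j, (if adj i j then Csp i j * (dot (T i - T j) (q i j))^2 else 0)
      + ∑ i ∈ Iplus ∪ Iminus, Cb i * (dot (T i) (qb i))^2) :
    ∃ C : ℝ, 0 < C ∧ ∀ T : Fin N → Fin 2 → ℝ,
      (∑ i, dot (T i) e1) = 0 → C * ∑ i, dot (T i) (T i) ≤ Qhom T := by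
  obtain ⟨m, v, -, hv, htri⟩ := henum
  let K : Submodule ℝ (Fin N → Fin 2 → ℝ) :=
    LinearMap.ker (∑ i, LinearMap.proj (R := ℝ) (φ := fun _ => ℝ) (0 : Fin 2) ∘ₗ
      LinearMap.proj (R := ℝ) (φ := fun _ : Fin N => Fin 2 → ℝ) i)
  have hK : ∀ T, T ∈ K ↔ ∑ i, dot (T i) e1 = 0 := fun T => by
    simp [K, dot, e1, LinearMap.sum_apply]
  have hQc : Continuous Qhom := by
    rw [funext hQhom]
    simp only [dot, Pi.sub_apply]
    refine .add (.mul continuous_const (continuous_finsetSum _ fun i _ =>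
      continuous_finsetSum _ fun j _ => ?_)) (by fun_prop)
    split_ifs <;> fun_prop
  have hQ : ∀ (c : ℝ) T, Qhom (c • T) = c ^ 2 * Qhom T := by
    intro c T
    rw [hQhom, hQhom, mul_add, mul_left_comm]
    simp only [Finset.mul_sum, dot, Pi.sub_apply, Pi.smul_apply, smul_eq_mul, mul_ite, mul_zero]
    congr 1
    · refine Finset.sum_congr rfl fun i _ => Finset.sum_congr rfl fun j _ => ?_
      split_ifs <;> ring
    · exact Finset.sum_congr rfl fun i _ => by ring
  have hpos : ∀ T ∈ K, T ≠ 0 → 0 < Qhom T := by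
    intro T hT hT0
    have hnn : ∀ i j, 0 ≤ if adj i j then Csp i j * (dot (T i - T j) (q i j))^2 else 0 := by
      intro i j
      split_ifs with h
      · exact mul_nonneg (hCsp_pos i j h).le (sq_nonneg _)
      · exact le_rfl
    have hnn' : ∀ i ∈ Iplus ∪ Iminus, 0 ≤ Cb i * (dot (T i) (qb i))^2 := fun i hi =>
      mul_nonneg (hCb_pos i hi).le (sq_nonneg _)
    have hrow : ∀ i ∈ Finset.univ,
        0 ≤ ∑ j, if adj i j then Csp i j * (dot (T i - T j) (q i j))^2 else 0 :=
      fun i _ => Finset.sum_nonneg fun j _ => hnn i j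
    have hsum := Finset.sum_nonneg hrow
    have hsum' := Finset.sum_nonneg hnn'
    by_contra hle
    rw [hQhom] at hle
    have hzero := (Finset.sum_eq_zero_iff_of_nonneg hrow).1 (by linarith)
    have hzero' := (Finset.sum_eq_zero_iff_of_nonneg hnn').1 (by linarith)
    have hedge : ∀ i j, adj i j → dot (T i - T j) (q i j) = 0 := by
      intro i j h
      have := (Finset.sum_eq_zero_iff_of_nonneg fun j _ => hnn i j).1
        (hzero i (Finset.mem_univ i)) j (Finset.mem_univ j)
      simpa [h, (hCsp_pos i j h).ne'] using this
    have hbdry : ∀ i ∈ Iminus, T i 1 = 0 := by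
      intro i hi
      have hmem := Finset.mem_union_right Iplus hi
      have := hzero' i hmem
      simpa [(hCb_pos i hmem).ne', hqb_minus i hi, dot, e2] using this
    obtain ⟨c, hc1, hc⟩ := exists_eq_of_strain_eq_zero hne hconn hv htri hedge hbdry
    have hN : N ≠ 0 := by
      rintro rfl
      exact hne.choose.elim0
    have hc0 : c 0 = 0 := by
      simpa [hc, dot, e1, hN] using (hK T).1 hT
    refine hT0 (funext fun i => (hc i).trans (funext fun k => ?_))
    fin_cases k
    exacts [hc0, hc1]
  obtain ⟨C, hC, h⟩ := exists_pos_mul_le_of_sq_homogeneous K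
    (P := fun T => ∑ i, dot (T i) (T i)) (by simp only [dot]; fun_prop) hQc
    (fun c T => by
      simp only [Finset.mul_sum, dot, Pi.smul_apply, smul_eq_mul]
      exact Finset.sum_congr rfl fun i _ => by ring) hQ hpos
  exact ⟨C, hC, fun T hT => h T ((hK T).2 hT)⟩
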